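/- The coproduct of su_ns^P(2) is compatible with the Poisson brackets on the generators: as smooth functions on ℝ³×ℝ³ one has {Δ(h), Δ(a)} = sinh(z(a+a'))/z, {Δ(a), Δ(b)} = 2Δ(h), and {Δ(h), Δ(b)} = −Δ(b)·cosh(z(a+a')), where the brackets on the left are the product Poisson bracket. -/

import Mathlib

/-- Partial derivative of a function on ℝ³ in the `i`-th coordinate direction. -/
noncomputable def pd (i : Fin 3) (f : (Fin 3 → ℝ) → ℝ) (x : Fin 3 → ℝ) : ℝ :=
  fderiv ℝ f x (Pi.single i 1)

/-- The bracket of the non-standard q-Poisson algebra su_ns^P(2) on ℝ³ with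
coordinates (h, a, b) = (x 0, x 1, x 2). -/
noncomputable def suns2Bracket (z : ℝ) (f g : (Fin 3 → ℝ) → ℝ) (x : Fin 3 → ℝ) : ℝ :=
  (Real.sinh (z * x 1) / z) * (pd 0 f x * pd 1 g x - pd 1 f x * pd 0 g x)
  - x 2 * Real.cosh (z * x 1) * (pd 0 f x * pd 2 g x - pd 2 f x * pd 0 g x)
  + 2 * x 0 * (pd 1 f x * pd 2 g x - pd 2 f x * pd 1 g x)

/-- The product Poisson bracket on ℝ³ × ℝ³. -/
noncomputable def suns2Bracket2 (z : ℝ) (F G : (Fin 3 → ℝ) × (Fin 3 → ℝ) → ℝ)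
    (p : (Fin 3 → ℝ) × (Fin 3 → ℝ)) : ℝ :=
  suns2Bracket z (fun y => F (y, p.2)) (fun y => G (y, p.2)) p.1
  + suns2Bracket z (fun y => F (p.1, y)) (fun y => G (p.1, y)) p.2

/-- Coproduct of F₁₂: Δ(a) = a + a'. -/
noncomputable def DA : (Fin 3 → ℝ) × (Fin 3 → ℝ) → ℝ := fun p => p.1 1 + p.2 1

/-- Coproduct of H: Δ(h) = e^{−za}h' + h·e^{za'}. -/
noncomputable def DH (z : ℝ) : (Fin 3 → ℝ) × (Fin 3 → ℝ) → ℝ := fun p =>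
  Real.exp (-(z * p.1 1)) * p.2 0 + p.1 0 * Real.exp (z * p.2 1)

/-- Coproduct of F₂₁: Δ(b) = e^{−za}b' + b·e^{za'}. -/
noncomputable def DB (z : ℝ) : (Fin 3 → ℝ) × (Fin 3 → ℝ) → ℝ := fun p =>
  Real.exp (-(z * p.1 1)) * p.2 2 + p.1 2 * Real.exp (z * p.2 1)

/-- Partial derivatives of a function of the form `y ↦ exp (c * y 1) * A + y k * B`. -/
theorem pd_exp_mul_add (i k : Fin 3) (c A B : ℝ) (x : Fin 3 → ℝ) :
    pd i (fun y => Real.exp (c * y 1) * A + y k * B) x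
      = c * Real.exp (c * x 1) * A * (Pi.single i 1 : Fin 3 → ℝ) 1
        + B * (Pi.single i 1 : Fin 3 → ℝ) k := by
  have hproj (j : Fin 3) : HasFDerivAt (fun y : Fin 3 → ℝ => y j)
      (ContinuousLinearMap.proj (R := ℝ) (φ := fun _ : Fin 3 => ℝ) j) x :=
    hasFDerivAt_apply j x
  have h := (((hproj 1).const_mul c).exp.mul_const A).add ((hproj k).mul_const B)
  rw [pd, HasFDerivAt.fderiv (f := fun y : Fin 3 → ℝ => Real.exp (c * y 1) * A + y k * B) h]
  simp
  ring

/-- Partial derivatives of a translated coordinate function. -/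
theorem pd_coord_add_const (i k : Fin 3) (C : ℝ) (x : Fin 3 → ℝ) :
    pd i (fun y => y k + C) x = (Pi.single i 1 : Fin 3 → ℝ) k := by
  have h := (hasFDerivAt_apply (𝕜 := ℝ) (F' := fun _ : Fin 3 => ℝ) k x).add_const C
  rw [pd, HasFDerivAt.fderiv (f := fun y : Fin 3 → ℝ => y k + C) h]
  simp

/-- Partial derivatives of `exp (-(z a)) x'ₖ + xₖ exp (z a')` in the first copy. -/
theorem pd_coproduct_left (i k : Fin 3) (z A B : ℝ) (x : Fin 3 → ℝ) :
    pd i (fun y => Real.exp (-(z * y 1)) * A + y k * B) x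
      = -z * Real.exp (-(z * x 1)) * A * (Pi.single i 1 : Fin 3 → ℝ) 1
        + B * (Pi.single i 1 : Fin 3 → ℝ) k := by
  simpa only [neg_mul] using pd_exp_mul_add i k (-z) A B x

/-- Partial derivatives of `exp (-(z a)) x'ₖ + xₖ exp (z a')` in the second copy. -/
theorem pd_coproduct_right (i k : Fin 3) (z A B : ℝ) (x : Fin 3 → ℝ) :
    pd i (fun y => B * y k + A * Real.exp (z * y 1)) x
      = z * Real.exp (z * x 1) * A * (Pi.single i 1 : Fin 3 → ℝ) 1
        + B * (Pi.single i 1 : Fin 3 → ℝ) k := by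
  rw [← pd_exp_mul_add]
  congr 1
  funext y
  ring

/-- Partial derivatives of a coordinate function translated on the left. -/
theorem pd_const_add_coord (i k : Fin 3) (C : ℝ) (x : Fin 3 → ℝ) :
    pd i (fun y => C + y k) x = (Pi.single i 1 : Fin 3 → ℝ) k := by
  simpa only [add_comm] using pd_coord_add_const i k C x

/-- the coproduct of su_ns^P(2) is compatible with the Poisson
brackets on the generators. -/
theorem suns2_coproduct_compatible (z : ℝ) (hz : z ≠ 0) :
    (∀ p, suns2Bracket2 z (DH z) DA p = Real.sinh (z * (p.1 1 + p.2 1)) / z) ∧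
    (∀ p, suns2Bracket2 z DA (DB z) p = 2 * DH z p) ∧
    (∀ p, suns2Bracket2 z (DH z) (DB z) p
        = - DB z p * Real.cosh (z * (p.1 1 + p.2 1))) := by
  refine ⟨fun p => ?_, fun p => ?_, fun p => ?_⟩
  all_goals
    simp only [suns2Bracket2, suns2Bracket, DH, DA, DB, pd_coproduct_left, pd_coproduct_right,
      pd_coord_add_const, pd_const_add_coord]
    simp
  · rw [mul_add, Real.sinh_eq, Real.sinh_eq, Real.sinh_eq, neg_add, Real.exp_add, Real.exp_add]
    field_simp
    ring
  · ring
  · rw [mul_add, Real.sinh_eq, Real.sinh_eq, Real.cosh_eq, Real.cosh_eq, Real.cosh_eq, neg_add,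
      Real.exp_add, Real.exp_add]
    simp only [Real.exp_neg]
    field_simp
    ring
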